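/- Let T on E be a factor of S on G via the factor transformation π. For every Θ-invariant measure μ ∈ I_P(E) there exists a Λ-invariant measure m ∈ I_P(G) with πm = μ. -/

import Mathlib

open MeasureTheory Set Filter Topology
open scoped ENNReal

namespace RelTail

variable {Ω W : Type*}

/-- The fiber over `ω` of a subset of a product space. -/
def fib (E : Set (Ω × W)) (ω : Ω) : Set W := {x | (ω, x) ∈ E}

/-- Minimal cardinality of a subfamily of the cover `R` whose fibers at `ω` cover the
fiber of `S` at `ω` (with the convention that the empty set needs one element). -/
noncomputable def coverNum (S : Set (Ω × W)) (R : Set (Set (Ω × W))) (ω : Ω) : ℕ :=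
  max 1 (sInf {n : ℕ | ∃ F : Finset (Set (Ω × W)), ↑F ⊆ R ∧ F.card = n ∧
    fib S ω ⊆ ⋃ u ∈ F, fib u ω})

/-- `N(R | Q)(ω) = max_{q ∈ Q} N(q, R)(ω)`. -/
noncomputable def relCoverNum (R Q : Set (Set (Ω × W))) (ω : Ω) : ℕ :=
  ⨆ q ∈ Q, coverNum q R ω

section Meas
variable [MeasurableSpace Ω] [MeasurableSpace W]

/-- A (finite or countable) random cover of `E`. -/
def IsRandomCover (E : Set (Ω × W)) (Q : Set (Set (Ω × W))) : Prop :=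
  Q.Countable ∧ (∀ q ∈ Q, MeasurableSet q) ∧ (∀ q ∈ Q, q ⊆ E) ∧
    ∀ ω, fib E ω ⊆ ⋃ q ∈ Q, fib q ω

/-- An open random cover: a random cover whose fibers are (a.e.) open in the fibers of `E`. -/
def IsOpenRandomCover [TopologicalSpace W] (P : Measure Ω) (E : Set (Ω × W))
    (Q : Set (Set (Ω × W))) : Prop :=
  IsRandomCover E Q ∧
    ∀ q ∈ Q, ∀ᵐ ω ∂P, ∃ U : Set W, IsOpen U ∧ fib q ω = U ∩ fib E ω

end Meas

/-- The join `⋁_{i<n} (Γ^i)^{-1} Q` of a cover (or partition). -/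
def iterJoin {Z : Type*} (Γ : Z → Z) (Q : Set (Set Z)) (n : ℕ) : Set (Set Z) :=
  {s | ∃ f : ℕ → Set Z, (∀ i, f i ∈ Q) ∧ s = ⋂ i ∈ Finset.range n, (Γ^[i]) ⁻¹' (f i)}

/-- `log N(R^{(n)} | Q^{(n)})(ω)`. -/
noncomputable def iterCoverLog (Θ : Ω × W → Ω × W) (R Q : Set (Set (Ω × W))) (n : ℕ)
    (ω : Ω) : ℝ :=
  Real.log (relCoverNum (iterJoin Θ R n) (iterJoin Θ Q n) ω)

/-- The relative tail entropy `h_Θ(R|Q)` of an open random cover `R` w.r.t. a random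
cover `Q`, as a limit (limsup) of `(1/n) ∫ log N(R^{(n)}|Q^{(n)}) dP`. -/
noncomputable def relCoverEnt [MeasurableSpace Ω] (P : Measure Ω) (Θ : Ω × W → Ω × W)
    (R Q : Set (Set (Ω × W))) : ℝ≥0∞ :=
  Filter.atTop.limsup fun n : ℕ => ENNReal.ofReal ((∫ ω, iterCoverLog Θ R Q n ω ∂P) / n)

/-- `h(Θ|Q)`: supremum over all open random covers `R` of `h_Θ(R|Q)`. -/
noncomputable def condTailEnt [MeasurableSpace Ω] [MeasurableSpace W] [TopologicalSpace W]
    (P : Measure Ω) (E : Set (Ω × W)) (Θ : Ω × W → Ω × W) (Q : Set (Set (Ω × W))) : ℝ≥0∞ :=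
  ⨆ R ∈ {R | IsOpenRandomCover P E R}, relCoverEnt P Θ R Q

/-- The relative tail entropy `h*(Θ)`: infimum over all random covers `Q` of `h(Θ|Q)`. -/
noncomputable def tailEnt [MeasurableSpace Ω] [MeasurableSpace W] [TopologicalSpace W]
    (P : Measure Ω) (E : Set (Ω × W)) (Θ : Ω × W → Ω × W) : ℝ≥0∞ :=
  ⨅ Q ∈ {Q | IsRandomCover E Q}, condTailEnt P E Θ Q

/-- The skew product transformation of a bundle RDS. -/
def skew (ϑ : Ω → Ω) (T : Ω → W → W) : Ω × W → Ω × W := fun p => (ϑ p.1, T p.1 p.2)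

/-- A continuous bundle random dynamical system over `(Ω, P, ϑ)` on `E`. -/
structure IsBundleRDS [MeasurableSpace Ω] [MeasurableSpace W] [TopologicalSpace W]
    (P : Measure Ω) (ϑ : Ω → Ω) (E : Set (Ω × W)) (T : Ω → W → W) : Prop where
  measurePreserving : MeasurePreserving ϑ P P
  measurable : Measurable fun p : Ω × W => T p.1 p.2
  mapsTo : ∀ ω, MapsTo (T ω) (fib E ω) (fib E (ϑ ω))
  continuousOn : ∀ᵐ ω ∂P, ContinuousOn (T ω) (fib E ω)

/-- A finite or countable measurable partition of a set `E`. -/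
def IsCountablePartition {Z : Type*} [MeasurableSpace Z] (E : Set Z) (R : Set (Set Z)) : Prop :=
  R.Countable ∧ (∀ s ∈ R, MeasurableSet s) ∧ (∀ s ∈ R, s ⊆ E) ∧
    R.PairwiseDisjoint id ∧ ⋃₀ R = E

/-- The conditional entropy `H_μ(R | m)` of a countable partition `R` given a
sub-σ-algebra `m`, via conditional expectations. -/
noncomputable def partCondEntropy {Z : Type*} (m : MeasurableSpace Z) [MeasurableSpace Z]
    (μ : Measure Z) (R : Set (Set Z)) : ℝ≥0∞ :=
  ∑' r : R, ENNReal.ofReal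
    (∫ z, Real.negMulLog ((μ[(r : Set Z).indicator (fun _ => (1 : ℝ)) | m]) z) ∂μ)

/-- The relative entropy `h_μ(R | m)` of the transformation `Γ` with respect to a
partition `R`, given the sub-σ-algebra `m`. -/
noncomputable def relEntPart {Z : Type*} (m : MeasurableSpace Z) [MeasurableSpace Z]
    (μ : Measure Z) (Γ : Z → Z) (R : Set (Set Z)) : ℝ≥0∞ :=
  Filter.atTop.limsup fun n : ℕ => partCondEntropy m μ (iterJoin Γ R n) / (n : ℝ≥0∞)

/-- The relative entropy `h_μ(Γ | m)` given the sub-σ-algebra `m`: supremum over all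
countable measurable partitions of `E` of finite conditional entropy. -/
noncomputable def relEnt {Z : Type*} (m : MeasurableSpace Z) [MeasurableSpace Z]
    (μ : Measure Z) (Γ : Z → Z) (E : Set Z) : ℝ≥0∞ :=
  ⨆ R ∈ {R | IsCountablePartition E R ∧ partCondEntropy m μ R ≠ ∞}, relEntPart m μ Γ R

/-- The fiberwise boundary `{(ω,x) : x ∈ ∂(R(ω))}` of a subset of a product space. -/
def fibFrontier [TopologicalSpace W] (R : Set (Ω × W)) : Set (Ω × W) :=
  {p | p.2 ∈ frontier (fib R p.1)}

/-- The sub-σ-algebra of `Ω × W₁ × W₂` generated by the first two coordinates,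
i.e. the σ-algebra `{(A × W₂) ∩ ⬝ : A ∈ F × B}`. -/
def firstPairSigma (Ω W₁ W₂ : Type*) [MeasurableSpace Ω] [MeasurableSpace W₁] :
    MeasurableSpace (Ω × W₁ × W₂) :=
  MeasurableSpace.comap (fun p : Ω × W₁ × W₂ => (p.1, p.2.1)) inferInstance

/-- The defect of upper semi-continuity of `f` at `m` relative to the set `S`. -/
noncomputable def uscDefect {M : Type*} [TopologicalSpace M] (f : M → ℝ≥0∞) (S : Set M)
    (m : M) : ℝ≥0∞ :=
  if f m ≠ ∞ then Filter.limsup f (𝓝[S] m) - f m else ∞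

/-- The factor (extension) transformation `(ω, y) ↦ (ω, π_ω y)`. -/
def factorMap {Y X : Type*} (πf : Ω → Y → X) : Ω × Y → Ω × X :=
  fun p => (p.1, πf p.1 p.2)

/-- `T` on `E` is a factor of `S` on `G` via the family `π_ω`. -/
structure IsFactor {Ω X Y : Type*} [MeasurableSpace Ω] [MeasurableSpace X] [MeasurableSpace Y]
    [TopologicalSpace X] [TopologicalSpace Y] (ϑ : Ω → Ω) (E : Set (Ω × X)) (G : Set (Ω × Y))
    (T : Ω → X → X) (S : Ω → Y → Y) (πf : Ω → Y → X) : Prop where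
  measurable : Measurable fun p : Ω × Y => πf p.1 p.2
  mapsTo : ∀ ω, MapsTo (πf ω) (fib G ω) (fib E ω)
  surjOn : ∀ ω, SurjOn (πf ω) (fib G ω) (fib E ω)
  continuousOn : ∀ ω, ContinuousOn (πf ω) (fib G ω)
  semiconj : ∀ ω, ∀ y ∈ fib G ω, πf (ϑ ω) (S ω y) = T ω (πf ω y)


section Aux

theorem analytic_inner {α : Type*} [TopologicalSpace α] [T2Space α] [MeasurableSpace α] [BorelSpace α]
    (μ : Measure α) [μ.OuterRegular] (f : (ℕ → ℕ) → α) (hf : Continuous f)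
    (t : ℝ≥0∞) (ht : t < μ (range f)) : ∃ K ⊆ range f, IsCompact K ∧ t ≤ μ K := by
  classical
  have step : ∀ (k : ℕ) (S : {S : Set (ℕ → ℕ) // t < μ (f '' S)}),
      ∃ n : ℕ, t < μ (f '' (S.1 ∩ {x | x k ≤ n})) := by
    intro k S
    have h1 : f '' S.1 = ⋃ n : ℕ, f '' (S.1 ∩ {x | x k ≤ n}) := by
      rw [← image_iUnion, ← inter_iUnion]
      congr 1
      ext x
      simp only [mem_inter_iff, mem_iUnion, mem_ofPred_eq]
      exact ⟨fun h => ⟨h, x k, le_rfl⟩, fun h => h.1⟩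
    have h2 : Monotone fun n : ℕ => f '' (S.1 ∩ {x | x k ≤ n}) := by
      intro a b hab
      apply image_mono
      intro x hx
      exact ⟨hx.1, le_trans hx.2 hab⟩
    have h3 := S.2
    rw [h1, h2.measure_iUnion] at h3
    exact lt_iSup_iff.1 h3
  choose n hn using step
  let Sq : ℕ → {S : Set (ℕ → ℕ) // t < μ (f '' S)} := fun k =>
    Nat.rec ⟨univ, by simpa using ht⟩ (fun k S => ⟨S.1 ∩ {x | x k ≤ n k S}, hn k S⟩) k
  let b : ℕ → ℕ := fun k => n k (Sq k)
  have hSq : ∀ k, (Sq k).1 = {x | ∀ i < k, x i ≤ b i} := by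
    intro k
    induction k with
    | zero => ext x; simp [Sq]
    | succ k ih =>
      have : (Sq (k+1)).1 = (Sq k).1 ∩ {x | x k ≤ b k} := rfl
      rw [this, ih]
      ext x
      simp only [mem_inter_iff, mem_ofPred_eq, Nat.lt_succ_iff_lt_or_eq]
      constructor
      · rintro ⟨h1, h2⟩ i (hi | rfl)
        · exact h1 i hi
        · exact h2
      · intro h
        exact ⟨fun i hi => h i (Or.inl hi), h k (Or.inr rfl)⟩
  let Kc : Set (ℕ → ℕ) := pi univ fun i => Iic (b i)
  have hKc : IsCompact Kc := isCompact_univ_pi fun i => (finite_Iic (b i)).isCompact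
  refine ⟨f '' Kc, image_subset_range _ _, hKc.image hf, ?_⟩
  rw [(f '' Kc).measure_eq_iInf_isOpen]
  refine le_iInf₂ fun U hU => le_iInf fun hUo => ?_
  let V := f ⁻¹' U
  have hV : IsOpen V := hUo.preimage hf
  let D : ℕ → Set (ℕ → ℕ) := fun m => {y | PiNat.cylinder y m ⊆ V}
  have hD : ∀ m, IsOpen (D m) := by
    intro m
    rw [isOpen_iff_forall_mem_open]
    intro y hy
    refine ⟨PiNat.cylinder y m, ?_, PiNat.isOpen_cylinder _ _ _, PiNat.self_mem_cylinder _ _⟩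
    intro z hz
    have : PiNat.cylinder z m = PiNat.cylinder y m := PiNat.mem_cylinder_iff_eq.1 hz
    simp only [D, mem_ofPred_eq, this]
    exact hy
  have hcov : Kc ⊆ ⋃ m, D m := by
    intro y hy
    have hyV : y ∈ V := hU (mem_image_of_mem f hy)
    obtain ⟨s, ⟨x, m, rfl⟩, h1, h2⟩ := (PiNat.isTopologicalBasis_cylinders (fun _ => ℕ)).exists_subset_of_mem_open hyV hV
    have : PiNat.cylinder y m = PiNat.cylinder x m := PiNat.mem_cylinder_iff_eq.1 h1
    exact mem_iUnion.2 ⟨m, by simpa only [D, mem_ofPred_eq, this] using h2⟩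
  have hdir : Directed (· ⊆ ·) D := by
    apply Monotone.directed_le
    intro a c hac y hy
    exact (PiNat.cylinder_anti y hac).trans hy
  obtain ⟨N, hN⟩ := hKc.elim_directed_cover D hD hcov hdir
  refine (Sq N).2.le.trans (measure_mono ?_)
  rw [hSq, image_subset_iff]
  intro z hz
  have h1 : (fun i => min (z i) (b i)) ∈ Kc := fun i _ => mem_Iic.2 (min_le_right _ _)
  apply hN h1
  intro i hi
  exact (min_eq_left (hz i hi)).symm

theorem analytic_null {α : Type*} [TopologicalSpace α] [T2Space α] [MeasurableSpace α] [BorelSpace α]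
    (μ : Measure α) [IsFiniteMeasure μ] [μ.OuterRegular] {A : Set α} (hA : AnalyticSet A) :
    NullMeasurableSet A μ := by
  rw [AnalyticSet] at hA
  rcases hA with rfl | ⟨f, hf, rfl⟩
  · exact nullMeasurableSet_empty
  by_cases h0 : μ (range f) = 0
  · exact NullMeasurableSet.of_null h0
  obtain ⟨u, -, hu, hu2⟩ := exists_seq_strictMono_tendsto' (pos_iff_ne_zero.2 h0)
  choose K hK1 hK2 hK3 using fun n => analytic_inner μ f hf (u n) (hu n).2
  have hB : MeasurableSet (⋃ n, K n) := MeasurableSet.iUnion fun n => (hK2 n).measurableSet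
  have hBs : (⋃ n, K n) ⊆ range f := iUnion_subset hK1
  have h2 : μ (range f) ≤ μ (⋃ n, K n) :=
    le_of_tendsto' hu2 fun n => (hK3 n).trans (measure_mono (subset_iUnion K n))
  refine NullMeasurableSet.congr hB.nullMeasurableSet ?_
  exact ae_eq_of_subset_of_measure_ge hBs h2 hB.nullMeasurableSet (measure_ne_top _ _)

theorem exists_code (Z : Type*) [MeasurableSpace Z] [MeasurableSpace.CountablyGenerated Z] :
    ∃ c : Z → (ℕ → Bool), Measurable c ∧
      (inferInstance : MeasurableSpace Z) = MeasurableSpace.comap c inferInstance := by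
  refine ⟨MeasurableSpace.mapNatBool Z, MeasurableSpace.measurable_mapNatBool Z, ?_⟩
  apply le_antisymm
  · conv_lhs => rw [← MeasurableSpace.generateFrom_natGeneratingSequence Z]
    apply MeasurableSpace.generateFrom_le
    rintro _ ⟨n, rfl⟩
    refine ⟨{x | x n = true}, measurableSet_eq_fun (measurable_pi_apply n) measurable_const, ?_⟩
    ext z
    simp [MeasurableSpace.mapNatBool]
  · exact (MeasurableSpace.measurable_mapNatBool Z).comap_le

theorem prod_code {Z Y : Type*} [mZ : MeasurableSpace Z] [mY : MeasurableSpace Y]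
    {c : Z → (ℕ → Bool)} 
    (h : mZ = MeasurableSpace.comap c inferInstance) {D : Set (Z × Y)} (hD : MeasurableSet D) :
    ∃ D' : Set ((ℕ → Bool) × Y), MeasurableSet D' ∧ D = Prod.map c id ⁻¹' D' := by
  have : (inferInstance : MeasurableSpace (Z × Y)) = 
      MeasurableSpace.comap (Prod.map c (id : Y → Y)) inferInstance := by
    subst h
    change MeasurableSpace.prod _ _ = MeasurableSpace.comap _ (MeasurableSpace.prod _ _)
    simp only [MeasurableSpace.prod, MeasurableSpace.comap_sup, MeasurableSpace.comap_comp]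
    rfl
  have hD' : MeasurableSet[MeasurableSpace.comap (Prod.map c (id : Y → Y)) inferInstance] D := by
    rw [← this]; exact hD
  obtain ⟨D', h1, h2⟩ := hD'
  exact ⟨D', h1, h2.symm⟩

theorem proj_null {Z Y : Type*} [MeasurableSpace Z] [MeasurableSpace.CountablyGenerated Z]
    [MetricSpace Y] [CompactSpace Y] [MeasurableSpace Y] [BorelSpace Y]
    (ν : Measure Z) [IsFiniteMeasure ν] {D : Set (Z × Y)} (hD : MeasurableSet D) :
    NullMeasurableSet (Prod.fst '' D) ν := by
  obtain ⟨c, hc, hc2⟩ := exists_code Z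
  obtain ⟨D', hD', rfl⟩ := prod_code hc2 hD
  have h1 : Prod.fst '' (Prod.map c (id : Y → Y) ⁻¹' D') = c ⁻¹' (Prod.fst '' D') := by
    ext z
    simp
  rw [h1]
  have : PolishSpace Y := inferInstance
  have : PolishSpace Bool := {}
  have h2 : AnalyticSet (Prod.fst '' D') := hD'.analyticSet.image_of_continuous continuous_fst
  exact (analytic_null (ν.map c) h2).preimage ⟨hc, Measure.AbsolutelyContinuous.rfl⟩

theorem inf_aem {Z Y : Type*} [MeasurableSpace Z] [MeasurableSpace.CountablyGenerated Z]
    [MetricSpace Y] [CompactSpace Y] [MeasurableSpace Y] [BorelSpace Y]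
    (ν : Measure Z) [IsFiniteMeasure ν] {D : Set (Z × Y)} (hD : MeasurableSet D) (d : Y) :
    AEMeasurable (fun z => ⨅ y ∈ {y | (z, y) ∈ D}, edist y d) ν := by
  apply NullMeasurable.aemeasurable
  apply measurable_of_Iio
  intro a
  have : (fun z => ⨅ y ∈ {y | (z, y) ∈ D}, edist y d) ⁻¹' Iio a
      = Prod.fst '' (D ∩ {p | edist p.2 d < a}) := by
    ext z
    simp [iInf_lt_iff]
  have h2 := proj_null ν (hD.inter (measurableSet_lt (f := fun p : Z × Y => edist p.2 d) (by fun_prop)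
    (measurable_const (a := a))))
  rw [← this] at h2
  exact h2

theorem selection {Z Y : Type*} [MeasurableSpace Z] [MeasurableSpace.CountablyGenerated Z]
    [MetricSpace Y] [CompactSpace Y] [MeasurableSpace Y] [BorelSpace Y] [Nonempty Y]
    (ν : Measure Z) [IsFiniteMeasure ν] {D : Set (Z × Y)} (hD : MeasurableSet D)
    (hc : ∀ᵐ z ∂ν, IsClosed {y | (z, y) ∈ D} ∧ {y | (z, y) ∈ D}.Nonempty) :
    ∃ s : Z → Y, Measurable s ∧ ∀ᵐ z ∂ν, (z, s z) ∈ D := by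
  let d := TopologicalSpace.denseSeq Y
  have hd : DenseRange d := TopologicalSpace.denseRange_denseSeq Y
  have step : ∀ (n : ℕ) (F : {F : Set (Z × Y) // MeasurableSet F}), ∃ v : Z → ℝ≥0∞, Measurable v ∧
      ∀ᵐ z ∂ν, (⨅ y ∈ {y | (z, y) ∈ F.1}, edist y (d n)) = v z :=
    fun n F => inf_aem ν F.2 (d n)
  choose v hv hv2 using step
  let F : ℕ → {F : Set (Z × Y) // MeasurableSet F} := fun k =>
    Nat.rec ⟨D, hD⟩ (fun k F => ⟨F.1 ∩ {p | edist p.2 (d k) = v k F p.1},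
      F.2.inter (measurableSet_eq_fun (by fun_prop) ((hv k F).comp measurable_fst))⟩) k
  have hF0 : (F 0).1 = D := rfl
  have hFs : ∀ k, (F (k+1)).1 = (F k).1 ∩ {p | edist p.2 (d k) = v k (F k) p.1} := fun k => rfl
  let w : Z → ℕ → ℝ≥0∞ := fun z k => v k (F k) z
  have hw : Measurable w := measurable_pi_lambda _ fun k => hv k (F k)
  let i : Y → ℕ → ℝ≥0∞ := fun y k => edist y (d k)
  have hi : Continuous i := by fun_prop
  have hinj : Function.Injective i := by
    intro x y hxy
    have h1 : (fun e => edist x e) = fun e => edist y e := by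
      apply hd.equalizer (by fun_prop) (by fun_prop)
      funext k
      exact congrFun hxy k
    have h2 := congrFun h1 y
    simpa using h2
  have hemb := hi.measurableEmbedding hinj
  obtain ⟨g, hg, hg2⟩ := hemb.exists_measurable_extend (f := i) measurable_id (fun _ => inferInstance)
  refine ⟨g ∘ w, hg.comp hw, ?_⟩
  have hall : ∀ᵐ z ∂ν, ∀ k, (⨅ y ∈ {y | (z, y) ∈ (F k).1}, edist y (d k)) = v k (F k) z :=
    ae_all_iff.2 fun k => hv2 k (F k)
  filter_upwards [hc, hall] with z hz hk
  have key : ∀ k, IsClosed {y | (z, y) ∈ (F k).1} ∧ {y | (z, y) ∈ (F k).1}.Nonempty := by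
    intro k
    induction k with
    | zero => exact hz
    | succ k ih =>
      have e : {y | (z, y) ∈ (F (k+1)).1} = {y | (z, y) ∈ (F k).1} ∩ {y | edist y (d k) = v k (F k) z} := by
        rw [hFs]; rfl
      rw [e]
      refine ⟨ih.1.inter (isClosed_eq (by fun_prop) continuous_const), ?_⟩
      obtain ⟨y, hy, hmin⟩ := ih.1.isCompact.exists_isMinOn ih.2
        (f := fun y => edist y (d k)) (by fun_prop)
      refine ⟨y, hy, ?_⟩
      rw [mem_ofPred_eq, ← hk k]
      exact le_antisymm (le_iInf₂ fun y' hy' => hmin hy') (iInf₂_le y hy)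
  have hne : (⋂ k, {y | (z, y) ∈ (F k).1}).Nonempty := by
    apply IsCompact.nonempty_iInter_of_sequence_nonempty_isCompact_isClosed
    · intro k y hy
      have : (z, y) ∈ (F (k+1)).1 := hy
      rw [hFs] at this
      exact this.1
    · exact fun k => (key k).2
    · exact (key 0).1.isCompact
    · exact fun k => (key k).1
  obtain ⟨y, hy⟩ := hne
  rw [mem_iInter] at hy
  have hiy : i y = w z := by
    funext k
    have : (z, y) ∈ (F (k+1)).1 := hy (k+1)
    rw [hFs] at this
    exact this.2
  have : g (w z) = y := by
    rw [← hiy]; exact congrFun hg2 y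
  simp only [Function.comp, this]
  exact hy 0


open ProbabilityTheory in
theorem exists_limit {Ω Y : Type*} [MeasurableSpace Ω]
    [MetricSpace Y] [CompactSpace Y] [MeasurableSpace Y] [BorelSpace Y] [Nonempty Y]
    (P : Measure Ω) [IsProbabilityMeasure P]
    (c : Ω → (ℕ → Bool)) (hc : Measurable c)
    (U : Ultrafilter ℕ) (ρ : ℕ → Measure (Ω × Y)) (hρ : ∀ n, IsProbabilityMeasure (ρ n))
    (hρP : ∀ n, (ρ n).map Prod.fst = P) :
    ∃ m : Measure (Ω × Y), IsProbabilityMeasure m ∧ m.map Prod.fst = P ∧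
      ∀ F : BoundedContinuousFunction ((ℕ → Bool) × Y) ℝ,
        Tendsto (fun n => ∫ z, F (c z.1, z.2) ∂(ρ n)) U (𝓝 (∫ z, F (c z.1, z.2) ∂m)) := by
  have hcm : Measurable (Prod.map c (id : Y → Y)) := hc.prodMap measurable_id
  let q : ℕ → ProbabilityMeasure ((ℕ → Bool) × Y) := fun n =>
    ⟨(ρ n).map (Prod.map c id), Measure.isProbabilityMeasure_map hcm.aemeasurable⟩
  obtain ⟨m', -, hm'⟩ := isCompact_univ.ultrafilter_le_nhds (U.map q) (by simp)
  have hq : Tendsto q U (𝓝 m') := hm'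
  let P' : ProbabilityMeasure (ℕ → Bool) := ⟨P.map c, Measure.isProbabilityMeasure_map hc.aemeasurable⟩
  have hfst : (m' : Measure ((ℕ → Bool) × Y)).map Prod.fst = P.map c := by
    have h1 := ProbabilityMeasure.tendsto_map_of_tendsto_of_continuous q m' hq
      (f := Prod.fst) continuous_fst
    have h2 : ∀ n, (q n).map (f := Prod.fst) continuous_fst.measurable.aemeasurable = P' := by
      intro n
      apply Subtype.ext
      change ((ρ n).map (Prod.map c id)).map Prod.fst = P.map c
      rw [Measure.map_map measurable_fst hcm, ← hρP n, Measure.map_map hc measurable_fst]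
      rfl
    simp only [h2] at h1
    have h3 := tendsto_nhds_unique tendsto_const_nhds h1
    have h4 := congrArg (fun x : ProbabilityMeasure _ => (x : Measure (ℕ → Bool))) h3
    exact h4.symm
  let κ := (m' : Measure ((ℕ → Bool) × Y)).condKernel
  let m : Measure (Ω × Y) := P.compProd (κ.comap c hc)
  have hm : IsProbabilityMeasure m := inferInstance
  have hmm : m.map (Prod.map c id) = m' := by
    ext s hs
    rw [Measure.map_apply hcm hs, Measure.compProd_apply (hcm hs)]
    have h1 : (m' : Measure ((ℕ → Bool) × Y)) s = ((P.map c).compProd κ) s := by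
      rw [← hfst]
      conv_lhs => rw [← Measure.disintegrate (m' : Measure ((ℕ → Bool) × Y)) κ]
      rfl
    rw [h1, Measure.compProd_apply hs, lintegral_map (Kernel.measurable_kernel_prodMk_left hs) hc]
    rfl
  refine ⟨m, hm, Measure.fst_compProd _ _, ?_⟩
  intro F
  have h1 := ProbabilityMeasure.tendsto_iff_forall_integral_tendsto.1 hq F
  have h2 : ∀ r : Measure (Ω × Y), ∫ z, F z ∂(r.map (Prod.map c id)) = ∫ z, F (c z.1, z.2) ∂r := by
    intro r
    rw [integral_map hcm.aemeasurable F.continuous.measurable.aestronglyMeasurable]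
    rfl
  rw [← hmm] at h1
  simp only [h2] at h1
  convert h1 using 2 with n
  exact (h2 (ρ n)).symm

theorem tendsto_approx {U : Filter ℕ} {a : ℕ → ℝ} {l : ℝ}
    (h : ∀ ε > 0, ∃ (b : ℕ → ℝ) (l' : ℝ), Tendsto b U (𝓝 l') ∧ (∀ n, |a n - b n| ≤ ε) ∧
      |l - l'| ≤ ε) : Tendsto a U (𝓝 l) := by
  rw [Metric.tendsto_nhds]
  intro ε hε
  obtain ⟨b, l', h1, h2, h3⟩ := h (ε / 4) (by positivity)
  filter_upwards [Metric.tendsto_nhds.1 h1 (ε / 4) (by positivity)] with n hn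
  rw [Real.dist_eq] at *
  have := h2 n
  rw [abs_le] at this h3
  rw [abs_lt] at *
  constructor <;> linarith [this.1, this.2, h3.1, h3.2, hn.1, hn.2]

theorem int_close {Ω Y : Type*} [MeasurableSpace Ω] [MeasurableSpace Y]
    {P : Measure Ω} {r : Measure (Ω × Y)} (hr : r.map Prod.fst = P)
    {f g : Ω × Y → ℝ} (hf : Integrable f r) (hg : Integrable g r) {u : Ω → ℝ}
    (hu : Integrable u P) (h : ∀ᵐ z ∂r, |f z - g z| ≤ u z.1) :
    |∫ z, f z ∂r - ∫ z, g z ∂r| ≤ ∫ ω, u ω ∂P := by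
  subst hr
  rw [← integral_sub hf hg, integral_map measurable_fst.aemeasurable hu.1]
  refine (abs_integral_le_integral_abs).trans ?_
  exact integral_mono_ae (hf.sub hg).abs (hu.comp_measurable measurable_fst) h

theorem ae_fst {Ω Y : Type*} [MeasurableSpace Ω] [MeasurableSpace Y]
    {P : Measure Ω} {r : Measure (Ω × Y)} (hr : r.map Prod.fst = P) {p : Ω → Prop}
    (h : ∀ᵐ ω ∂P, p ω) : ∀ᵐ z ∂r, p z.1 := by
  subst hr
  exact ae_of_ae_map measurable_fst.aemeasurable h

theorem int_bdd {Z : Type*} [MeasurableSpace Z] (r : Measure Z) [IsFiniteMeasure r] {f : Z → ℝ}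
    (hf : Measurable f) {M : ℝ} (hM : ∀ z, |f z| ≤ M) : Integrable f r :=
  Integrable.of_bound hf.aestronglyMeasurable M (Eventually.of_forall hM)

/-- test function -/
noncomputable def tst {Ω Y : Type*} (A : Set Ω) (φ : Y → ℝ) (z : Ω × Y) : ℝ :=
  A.indicator (fun _ => (1 : ℝ)) z.1 * φ z.2

theorem tst_meas {Ω Y : Type*} [MeasurableSpace Ω] [MeasurableSpace Y] {A : Set Ω}
    (hA : MeasurableSet A) {φ : Y → ℝ} (hφ : Measurable φ) : Measurable (tst A φ) :=
  ((measurable_const.indicator hA).comp measurable_fst).mul (hφ.comp measurable_snd)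

theorem tst_bdd {Ω Y : Type*} (A : Set Ω) {φ : Y → ℝ} {M : ℝ} (hM : ∀ y, |φ y| ≤ M) (z : Ω × Y) :
    |tst A φ z| ≤ M := by
  have := hM z.2
  have h0 : 0 ≤ M := (abs_nonneg _).trans this
  unfold tst
  by_cases h : z.1 ∈ A <;> simp [h, this, h0]

theorem cont_bdd {Y : Type*} [TopologicalSpace Y] [CompactSpace Y] (φ : C(Y, ℝ)) (y : Y) :
    |φ y| ≤ ‖φ‖ := φ.norm_coe_le_norm y

theorem limit_tst {Ω Y : Type*} [mΩ : MeasurableSpace Ω]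
    [MetricSpace Y] [CompactSpace Y] [MeasurableSpace Y] [BorelSpace Y]
    (P : Measure Ω) [IsProbabilityMeasure P]
    (c : Ω → (ℕ → Bool)) (hc : Measurable c) (hc2 : mΩ = MeasurableSpace.comap c inferInstance)
    (U : Ultrafilter ℕ) (ρ : ℕ → Measure (Ω × Y)) (hρ : ∀ n, IsProbabilityMeasure (ρ n))
    (hρP : ∀ n, (ρ n).map Prod.fst = P) (m : Measure (Ω × Y)) [IsProbabilityMeasure m]
    (hmP : m.map Prod.fst = P)
    (hlim : ∀ F : BoundedContinuousFunction ((ℕ → Bool) × Y) ℝ,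
        Tendsto (fun n => ∫ z, F (c z.1, z.2) ∂(ρ n)) U (𝓝 (∫ z, F (c z.1, z.2) ∂m)))
    {A : Set Ω} (hA : MeasurableSet A) (φ : C(Y, ℝ)) :
    Tendsto (fun n => ∫ z, tst A φ z ∂(ρ n)) U (𝓝 (∫ z, tst A φ z ∂m)) := by
  have hA2 : MeasurableSet[MeasurableSpace.comap c inferInstance] A := by
    rw [← hc2]; exact hA
  obtain ⟨A', hA', hAA⟩ := hA2
  apply tendsto_approx
  intro ε hε
  have hpos : 0 < ‖φ‖ + 1 := by positivity
  have : IsProbabilityMeasure (P.map c) := Measure.isProbabilityMeasure_map hc.aemeasurable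
  obtain ⟨h, hh1, hh2⟩ := Integrable.exists_boundedContinuous_integral_sub_le
    (μ := P.map c) (f := A'.indicator (fun _ => (1:ℝ)))
    ((integrable_const 1).indicator hA') (ε := ε / (‖φ‖ + 1)) (by positivity)
  let F : BoundedContinuousFunction ((ℕ → Bool) × Y) ℝ := 
    BoundedContinuousFunction.mkOfCompact ⟨fun z => h z.1 * φ z.2, by fun_prop⟩
  have hFm : Measurable fun z : Ω × Y => F (c z.1, z.2) :=
    F.continuous.measurable.comp ((hc.comp measurable_fst).prodMk measurable_snd)
  have key : ∀ r : Measure (Ω × Y), IsProbabilityMeasure r → r.map Prod.fst = P →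
      |∫ z, tst A φ z ∂r - ∫ z, F (c z.1, z.2) ∂r| ≤ ε := by
    intro r hr hrP
    have hint : Integrable (fun k => |A'.indicator (fun _ => (1:ℝ)) k - h k| * ‖φ‖) (P.map c) :=
      ((((integrable_const 1).indicator hA').sub hh2).abs).mul_const _
    refine (int_close hrP (int_bdd r (tst_meas hA φ.continuous.measurable) (tst_bdd A (cont_bdd φ)))
      (int_bdd r hFm (M := ‖F‖) fun z => F.norm_coe_le_norm _)
      (u := fun ω => |A'.indicator (fun _ => (1:ℝ)) (c ω) - h (c ω)| * ‖φ‖)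
      (hint.comp_measurable hc) (Eventually.of_forall fun z => ?_)).trans ?_
    · have e1 : A.indicator (fun _ => (1:ℝ)) z.1 = A'.indicator (fun _ => (1:ℝ)) (c z.1) := by
        rw [← hAA]; rfl
      have e2 : F (c z.1, z.2) = h (c z.1) * φ z.2 := rfl
      rw [tst, e1, e2, ← sub_mul, abs_mul]
      exact mul_le_mul_of_nonneg_left (cont_bdd φ _) (abs_nonneg _)
    · have e := integral_map (μ := P) hc.aemeasurable hint.1
      rw [← e, integral_mul_const]
      simp only [Real.norm_eq_abs] at hh1
      calc _ ≤ ε / (‖φ‖ + 1) * ‖φ‖ := mul_le_mul_of_nonneg_right hh1 (norm_nonneg _)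
        _ ≤ ε := by
          rw [div_mul_eq_mul_div, div_le_iff₀ hpos]
          nlinarith [norm_nonneg φ]
  exact ⟨_, _, hlim F, fun n => key _ (hρ n) (hρP n), key m inferInstance hmP⟩

theorem exists_pos_fun {Y : Type*} [MetricSpace Y] {V : Set Y} (hV : IsOpen V) :
    ∃ φ : C(Y, ℝ), (∀ y, 0 ≤ φ y) ∧ ∀ y, φ y ≠ 0 ↔ y ∈ V := by
  by_cases h : (Vᶜ).Nonempty
  · refine ⟨⟨fun y => Metric.infDist y Vᶜ, Metric.continuous_infDist_pt _⟩,
      fun y => Metric.infDist_nonneg, fun y => ?_⟩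
    have := hV.isClosed_compl.mem_iff_infDist_zero h (x := y)
    simp only [ContinuousMap.coe_mk, ne_eq, ← this]
    simp
  · have : V = univ := by simpa [not_nonempty_iff_eq_empty] using h
    exact ⟨1, by simp, by simp [this]⟩

theorem limit_G {Ω Y : Type*} [MeasurableSpace Ω] [MeasurableSpace.CountablyGenerated Ω]
    [MetricSpace Y] [CompactSpace Y] [MeasurableSpace Y] [BorelSpace Y]
    (P : Measure Ω) [IsProbabilityMeasure P]
    {G : Set (Ω × Y)} (hG : MeasurableSet G) (hGc : ∀ ω, IsClosed {y | (ω, y) ∈ G})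
    (U : Ultrafilter ℕ) (ρ : ℕ → Measure (Ω × Y))
    (hρP : ∀ n, (ρ n).map Prod.fst = P) (hρG : ∀ n, ∀ᵐ z ∂(ρ n), z ∈ G)
    (m : Measure (Ω × Y)) [IsProbabilityMeasure m]
    (hmP : m.map Prod.fst = P)
    (hlim : ∀ A : Set Ω, MeasurableSet A → ∀ φ : C(Y, ℝ), 
      Tendsto (fun n => ∫ z, tst A φ z ∂(ρ n)) U (𝓝 (∫ z, tst A φ z ∂m))) :
    ∀ᵐ z ∂m, z ∈ G := by
  have key : ∀ V ∈ TopologicalSpace.countableBasis Y, ∀ᵐ z ∂m,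
      z.2 ∈ V → ∃ y ∈ V, (z.1, y) ∈ G := by
    intro V hV
    have hVo := TopologicalSpace.isOpen_of_mem_countableBasis hV
    obtain ⟨φ, h0, hφ⟩ := exists_pos_fun hVo
    have hN : NullMeasurableSet (Prod.fst '' (G ∩ {p | p.2 ∈ V}))ᶜ P :=
      (proj_null P (hG.inter (measurable_snd hVo.measurableSet))).compl
    obtain ⟨A, hA, hAe⟩ := hN
    have hmem : ∀ᵐ ω ∂P, (ω ∈ A ↔ ¬ ∃ y ∈ V, (ω, y) ∈ G) := by
      filter_upwards [hAe.mem_iff] with ω h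
      rw [← h]
      simp [and_comm]
    have hz : ∀ n, ∫ z, tst A φ z ∂(ρ n) = 0 := by
      intro n
      apply integral_eq_zero_of_ae
      filter_upwards [hρG n, ae_fst (hρP n) hmem] with z h1 h2
      simp only [tst, Pi.zero_apply, mul_eq_zero]
      by_cases hzV : z.2 ∈ V
      · left
        apply indicator_of_notMem
        rw [h2, not_not]
        exact ⟨z.2, hzV, h1⟩
      · right
        by_contra hne
        exact hzV ((hφ _).1 hne)
    have hl := hlim A hA φ
    simp only [hz] at hl
    have hm0 := (tendsto_nhds_unique tendsto_const_nhds hl).symm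
    rw [integral_eq_zero_iff_of_nonneg (f := tst A φ)
      (fun z => mul_nonneg (indicator_nonneg (fun _ _ => zero_le_one) _) (h0 _))
      (int_bdd m (tst_meas hA φ.continuous.measurable) (tst_bdd A (cont_bdd φ)))] at hm0
    filter_upwards [hm0, ae_fst hmP hmem] with z h1 h2 h3
    by_contra hcon
    have hzA := h2.2 hcon
    simp only [tst, indicator_of_mem hzA, one_mul, Pi.zero_apply] at h1
    exact (hφ _).2 h3 h1
  have hall := (ae_ball_iff (TopologicalSpace.countable_countableBasis Y)).2 key
  filter_upwards [hall] with z hz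
  by_contra hzG
  obtain ⟨V, hV, h1, h2⟩ := (TopologicalSpace.isBasis_countableBasis Y).exists_subset_of_mem_open
    (show z.2 ∈ {y | (z.1, y) ∈ G}ᶜ from hzG) (hGc z.1).isOpen_compl
  obtain ⟨y, hy, hyG⟩ := hz V hV h1
  exact h2 hy hyG

theorem limit_all {Ω Y : Type*} [MeasurableSpace Ω] [MeasurableSpace.CountablyGenerated Ω]
    [MetricSpace Y] [CompactSpace Y] [MeasurableSpace Y] [BorelSpace Y]
    (P : Measure Ω) [IsProbabilityMeasure P]
    {G : Set (Ω × Y)} (hG : MeasurableSet G) (hGc : ∀ ω, IsClosed {y | (ω, y) ∈ G})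
    (U : Ultrafilter ℕ) (ρ : ℕ → Measure (Ω × Y)) (hρ : ∀ n, IsProbabilityMeasure (ρ n))
    (hρP : ∀ n, (ρ n).map Prod.fst = P) (hρG : ∀ n, ∀ᵐ z ∂(ρ n), z ∈ G)
    (m : Measure (Ω × Y)) [IsProbabilityMeasure m]
    (hmP : m.map Prod.fst = P) (hmG : ∀ᵐ z ∂m, z ∈ G)
    (hlim : ∀ A : Set Ω, MeasurableSet A → ∀ φ : C(Y, ℝ), 
      Tendsto (fun n => ∫ z, tst A φ z ∂(ρ n)) U (𝓝 (∫ z, tst A φ z ∂m)))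
    {f : Ω × Y → ℝ} (hf : Measurable f) {M : ℝ} (hM : ∀ z, |f z| ≤ M)
    (hfc : ∀ᵐ ω ∂P, ContinuousOn (fun y => f (ω, y)) {y | (ω, y) ∈ G}) :
    Tendsto (fun n => ∫ z, f z ∂(ρ n)) U (𝓝 (∫ z, f z ∂m)) := by
  have hM0 : 0 ≤ M := by
    obtain ⟨z⟩ : Nonempty (Ω × Y) := nonempty_of_isProbabilityMeasure m
    exact (abs_nonneg _).trans (hM z)
  apply tendsto_approx
  intro ε hε
  let φ : ℕ → C(Y, ℝ) := TopologicalSpace.denseSeq C(Y, ℝ)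
  have hφ : DenseRange φ := TopologicalSpace.denseRange_denseSeq _
  have hN : ∀ n, NullMeasurableSet (Prod.fst '' (G ∩ {p | ε / 2 ≤ |f p - φ n p.2|}))ᶜ P := fun n =>
    (proj_null P (hG.inter (measurableSet_le measurable_const
      ((hf.sub ((φ n).continuous.measurable.comp measurable_snd)).abs)))).compl
  choose A hA hAe using hN
  have hmem : ∀ᵐ ω ∂P, ∀ n, (ω ∈ A n ↔ ∀ y, (ω, y) ∈ G → |f (ω, y) - φ n y| < ε / 2) := by
    rw [ae_all_iff]
    intro n
    filter_upwards [(hAe n).mem_iff] with ω h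
    rw [← h]
    simp
  have hcov : ∀ᵐ ω ∂P, ω ∈ ⋃ n, A n := by
    filter_upwards [hmem, hfc] with ω h1 h2
    obtain ⟨g, hg⟩ := ContinuousMap.exists_restrict_eq (hGc ω)
      ⟨_, h2.domRestrict⟩
    obtain ⟨n, hn⟩ := hφ.exists_dist_lt g (half_pos hε)
    refine mem_iUnion.2 ⟨n, (h1 n).2 fun y hy => ?_⟩
    have e : g y = f (ω, y) := DFunLike.congr_fun hg ⟨y, hy⟩
    rw [← e, ← Real.dist_eq]
    exact (ContinuousMap.dist_apply_le_dist y).trans_lt hn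
  let B := disjointed A
  have hB : ∀ n, MeasurableSet (B n) := MeasurableSet.disjointed hA
  have hBU : ⋃ n, B n = ⋃ n, A n := iUnion_disjointed
  let C : ℕ → Set Ω := fun N => (⋃ n ∈ Finset.range N, B n)ᶜ
  have hC : ∀ N, MeasurableSet (C N) := fun N =>
    (Finset.measurableSet_biUnion _ fun n _ => hB n).compl
  have hC0 : Tendsto (fun N => P.real (C N)) atTop (𝓝 0) := by
    have h1 := tendsto_measure_iInter_atTop (μ := P) (s := C) (fun N => (hC N).nullMeasurableSet)
      (by
        intro a b hab
        apply compl_subset_compl.2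
        exact biUnion_subset_biUnion_left (fun x hx => by simp at *; omega))
      ⟨0, measure_ne_top _ _⟩
    have h2 : P (⋂ N, C N) = 0 := by
      refine measure_mono_null ?_ (ae_iff.1 hcov)
      intro ω hω hω2
      rw [← hBU] at hω2
      obtain ⟨n, hn⟩ := mem_iUnion.1 hω2
      have := mem_iInter.1 hω (n+1)
      exact this (mem_biUnion (show n ∈ Finset.range (n+1) by simp) hn)
    rw [h2] at h1
    exact (ENNReal.tendsto_toReal ENNReal.zero_ne_top).comp h1
  have hC1 : Tendsto (fun N => M * P.real (C N)) atTop (𝓝 0) := by simpa using hC0.const_mul M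
  obtain ⟨N, hNε⟩ := (hC1.eventually (gt_mem_nhds (half_pos hε))).exists
  let g : Ω × Y → ℝ := fun z => ∑ k ∈ Finset.range N, tst (B k) (φ k) z
  have hti : ∀ (r : Measure (Ω × Y)) [IsProbabilityMeasure r] (k : ℕ), Integrable (tst (B k) (φ k)) r :=
    fun r _ k => int_bdd r (tst_meas (hB k) (φ k).continuous.measurable) (tst_bdd _ (cont_bdd _))
  have hgi : ∀ (r : Measure (Ω × Y)) [IsProbabilityMeasure r],
      ∫ z, g z ∂r = ∑ k ∈ Finset.range N, ∫ z, tst (B k) (φ k) z ∂r :=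
    fun r _ => integral_finsetSum _ fun k _ => hti r k
  have hglim : Tendsto (fun n => ∫ z, g z ∂(ρ n)) U (𝓝 (∫ z, g z ∂m)) := by
    have : ∀ n, ∫ z, g z ∂(ρ n) = ∑ k ∈ Finset.range N, ∫ z, tst (B k) (φ k) z ∂(ρ n) :=
      fun n => hgi _
    simp only [this, hgi m]
    exact tendsto_finsetSum _ fun k _ => hlim _ (hB k) _
  have key : ∀ r : Measure (Ω × Y), IsProbabilityMeasure r → r.map Prod.fst = P →
      (∀ᵐ z ∂r, z ∈ G) → |∫ z, f z ∂r - ∫ z, g z ∂r| ≤ ε := by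
    intro r hr hrP hrG
    refine (int_close hrP (g := g) (int_bdd r hf hM)
      (integrable_finsetSum _ fun k _ => hti r k)
      (u := fun ω => ε / 2 + (C N).indicator (fun _ => M) ω)
      ((integrable_const _).add ((integrable_const _).indicator (hC N))) ?_).trans ?_
    · filter_upwards [hrG, ae_fst hrP hmem] with z h1 h2
      by_cases hz : z.1 ∈ C N
      · have : g z = 0 := by
          apply Finset.sum_eq_zero
          intro k hk
          have : z.1 ∉ B k := fun h => hz (mem_biUnion hk h)
          simp [tst, this]
        rw [this, sub_zero, indicator_of_mem hz]
        linarith [hM z]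
      · rw [indicator_of_notMem hz, add_zero]
        have hz' : z.1 ∈ ⋃ n ∈ Finset.range N, B n := by simpa [C] using hz
        simp only [mem_iUnion] at hz'
        obtain ⟨k, hk, hzk⟩ := hz'
        have : g z = φ k z.2 := by
          change ∑ k ∈ Finset.range N, tst (B k) (φ k) z = _
          rw [Finset.sum_eq_single k]
          · simp [tst, hzk]
          · intro j _ hj
            have : z.1 ∉ B j := fun h =>
              (disjoint_left.1 (disjoint_disjointed A hj)) h hzk
            simp [tst, this]
          · exact fun h => absurd hk h
        rw [this]
        exact ((h2 k).1 (disjointed_subset A k hzk) z.2 h1).le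
    · rw [integral_add (integrable_const _) ((integrable_const _).indicator (hC N)),
        integral_indicator_const _ (hC N)]
      simp only [integral_const, probReal_univ, smul_eq_mul, one_mul]
      linarith [mul_comm M (P.real (C N))]
  exact ⟨_, _, hglim, fun n => key _ (hρ n) (hρP n) (hρG n), key m inferInstance hmP hmG⟩

theorem ext_tst {Ω Y : Type*} [MeasurableSpace Ω]
    [MetricSpace Y] [CompactSpace Y] [MeasurableSpace Y] [BorelSpace Y]
    {r s : Measure (Ω × Y)} [IsFiniteMeasure r] [IsFiniteMeasure s]
    (h : ∀ A : Set Ω, MeasurableSet A → ∀ φ : C(Y, ℝ), ∫ z, tst A φ z ∂r = ∫ z, tst A φ z ∂s) :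
    r = s := by
  apply Measure.ext_prod
  intro A B hA hB
  have hA' : MeasurableSet (Prod.fst ⁻¹' A : Set (Ω × Y)) := measurable_fst hA
  have e : (r.restrict (Prod.fst ⁻¹' A)).map Prod.snd = (s.restrict (Prod.fst ⁻¹' A)).map Prod.snd := by
    apply ext_of_forall_integral_eq_of_IsFiniteMeasure
    intro φ
    have h1 : ∀ q : Measure (Ω × Y), ∫ y, φ y ∂((q.restrict (Prod.fst ⁻¹' A)).map Prod.snd)
        = ∫ z, tst A φ z ∂q := by
      intro q
      rw [integral_map measurable_snd.aemeasurable φ.continuous.measurable.aestronglyMeasurable,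
        ← integral_indicator hA']
      congr 1
      funext z
      by_cases hz : z.1 ∈ A <;> simp [tst, hz, indicator]
    rw [h1, h1]
    exact h A hA φ.toContinuousMap
  have e2 := congrArg (fun q => q B) e
  simp only [Measure.map_apply measurable_snd hB, Measure.restrict_apply (measurable_snd hB)] at e2
  have e3 : A ×ˢ B = Prod.snd ⁻¹' B ∩ Prod.fst ⁻¹' A := by
    ext z; simp [and_comm]
  rw [e3]; exact e2

end Aux

/-- every `Θ`-invariant measure `μ ∈ I_P(E)` lifts to a `Λ`-invariant
measure `m ∈ I_P(G)` with `πm = μ`. -/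
theorem exists_invariant_lift
    {Ω X Y : Type*} [MeasurableSpace Ω] [MeasurableSpace.CountablyGenerated Ω]
    [MetricSpace X] [CompactSpace X] [MeasurableSpace X] [BorelSpace X]
    [MetricSpace Y] [CompactSpace Y] [MeasurableSpace Y] [BorelSpace Y]
    (P : Measure Ω) [IsProbabilityMeasure P] (hP : P.IsComplete)
    (ϑ : Ω → Ω) (E : Set (Ω × X)) (hE : MeasurableSet E) (hEc : ∀ ω, IsCompact (fib E ω))
    (G : Set (Ω × Y)) (hG : MeasurableSet G) (hGc : ∀ ω, IsCompact (fib G ω))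
    (T : Ω → X → X) (hT : IsBundleRDS P ϑ E T)
    (S : Ω → Y → Y) (hS : IsBundleRDS P ϑ G S)
    (πf : Ω → Y → X) (hπ : IsFactor ϑ E G T S πf)
    (hπm : Measurable (factorMap πf))
    (μ : Measure (Ω × X)) (hμp : IsProbabilityMeasure μ)
    (hμP : μ.map Prod.fst = P) (hμE : μ E = 1)
    (hμinv : μ.map (skew ϑ T) = μ) :
    ∃ m : Measure (Ω × Y), IsProbabilityMeasure m ∧ m.map Prod.fst = P ∧ m G = 1 ∧
      m.map (skew ϑ S) = m ∧ m.map (factorMap πf) = μ := by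
  obtain ⟨ze, hze⟩ : E.Nonempty := by
    by_contra h
    rw [not_nonempty_iff_eq_empty] at h
    simp [h] at hμE
  obtain ⟨y0, -, -⟩ := hπ.surjOn ze.1 hze
  have : Nonempty Y := ⟨y0⟩
  have hGcl : ∀ ω, IsClosed {y | (ω, y) ∈ G} := fun ω => (hGc ω).isClosed
  have hEae : ∀ᵐ z ∂μ, z ∈ E := by
    rw [← prob_compl_eq_zero_iff hE] at hμE
    exact hμE
  have hϑ : Measurable ϑ := hS.measurePreserving.measurable
  have hΛ : Measurable (skew ϑ S) := (hϑ.comp measurable_fst).prodMk hS.measurable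
  have hΘ : Measurable (skew ϑ T) := (hϑ.comp measurable_fst).prodMk hT.measurable
  -- initial lift
  let D : Set ((Ω × X) × Y) := {p | (p.1.1, p.2) ∈ G ∧ πf p.1.1 p.2 = p.1.2}
  have hpm : Measurable fun p : (Ω × X) × Y => (p.1.1, p.2) := by fun_prop
  have hD : MeasurableSet D :=
    (hpm hG).inter (measurableSet_eq_fun (hπ.measurable.comp hpm) (by fun_prop))
  obtain ⟨s, hs, hsD⟩ := selection μ hD (by
    filter_upwards [hEae] with z hz
    constructor
    · have : {y | (z, y) ∈ D} = fib G z.1 ∩ (πf z.1) ⁻¹' {z.2} := rfl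
      rw [this]
      exact (hπ.continuousOn z.1).preimage_isClosed_of_isClosed (hGc z.1).isClosed isClosed_singleton
    · obtain ⟨y, hy, hy2⟩ := hπ.surjOn z.1 hz
      exact ⟨y, hy, hy2⟩)
  have hsm : Measurable fun z : Ω × X => (z.1, s z) := measurable_fst.prodMk hs
  let m0 : Measure (Ω × Y) := μ.map fun z => (z.1, s z)
  have hm0 : (∀ᵐ z ∂m0, z ∈ G) ∧ m0.map (factorMap πf) = μ := by
    constructor
    · refine (ae_map_iff (p := fun z => z ∈ G) hsm.aemeasurable hG).2 ?_
      filter_upwards [hsD] with z hz using hz.1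
    · rw [Measure.map_map hπm hsm]
      have : (factorMap πf ∘ fun z : Ω × X => (z.1, s z)) =ᵐ[μ] id := by
        filter_upwards [hsD] with z hz
        exact Prod.ext rfl hz.2
      rw [Measure.map_congr this, Measure.map_id]
  let ρ : ℕ → Measure (Ω × Y) := fun k => Nat.rec m0 (fun _ r => r.map (skew ϑ S)) k
  have hρs : ∀ k, ρ (k+1) = (ρ k).map (skew ϑ S) := fun k => rfl
  have hρ : ∀ k, (∀ᵐ z ∂(ρ k), z ∈ G) ∧ (ρ k).map (factorMap πf) = μ := by
    intro k
    induction k with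
    | zero => exact hm0
    | succ k ih =>
      rw [hρs]
      constructor
      · refine (ae_map_iff (p := fun z => z ∈ G) hΛ.aemeasurable hG).2 ?_
        filter_upwards [ih.1] with z hz
        exact hS.mapsTo z.1 hz
      · rw [Measure.map_map hπm hΛ]
        have : (factorMap πf ∘ skew ϑ S) =ᵐ[ρ k] (skew ϑ T ∘ factorMap πf) := by
          filter_upwards [ih.1] with z hz
          exact Prod.ext rfl (hπ.semiconj z.1 z.2 hz)
        rw [Measure.map_congr this, ← Measure.map_map hΘ hπm, ih.2, hμinv]
  have hprob : ∀ r : Measure (Ω × Y), r.map (factorMap πf) = μ → IsProbabilityMeasure r := by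
    intro r hr
    constructor
    have h1 := congrArg (fun q => q univ) hr
    simp only [Measure.map_apply hπm MeasurableSet.univ, preimage_univ, measure_univ] at h1
    exact h1
  have hfst : ∀ r : Measure (Ω × Y), r.map (factorMap πf) = μ → r.map Prod.fst = P := by
    intro r hr
    rw [← hμP, ← hr, Measure.map_map measurable_fst hπm]
    rfl
  have hρp : ∀ k, IsProbabilityMeasure (ρ k) := fun k => hprob _ (hρ k).2
  -- averages
  let M : ℕ → Measure (Ω × Y) := fun n =>
    ((n + 1 : ℕ) : ℝ≥0∞)⁻¹ • ∑ k ∈ Finset.range (n + 1), ρ k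
  have hinv : ∀ n : ℕ, ((n + 1 : ℕ) : ℝ≥0∞)⁻¹ * ((n + 1 : ℕ) : ℝ≥0∞) = 1 := fun n =>
    ENNReal.inv_mul_cancel (by simp) (ENNReal.natCast_ne_top _)
  have hMπ : ∀ n, (M n).map (factorMap πf) = μ := by
    intro n
    ext t ht
    simp only [M, Measure.map_apply hπm ht, Measure.smul_apply, Measure.finsetSum_apply, smul_eq_mul]
    have : ∀ k, ρ k (factorMap πf ⁻¹' t) = μ t := by
      intro k
      rw [← Measure.map_apply hπm ht, (hρ k).2]
    simp only [this, Finset.sum_const, Finset.card_range, nsmul_eq_mul]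
    rw [← mul_assoc, hinv, one_mul]
  have hMG : ∀ n, ∀ᵐ z ∂(M n), z ∈ G := by
    intro n
    rw [ae_iff]
    simp only [M, Measure.smul_apply, Measure.finsetSum_apply, smul_eq_mul]
    rw [Finset.sum_eq_zero, mul_zero]
    intro k _
    exact ae_iff.1 (hρ k).1
  have hMp : ∀ n, IsProbabilityMeasure (M n) := fun n => hprob _ (hMπ n)
  have hMP : ∀ n, (M n).map Prod.fst = P := fun n => hfst _ (hMπ n)
  let U : Ultrafilter ℕ := Ultrafilter.of atTop
  have hU : (U : Filter ℕ) ≤ atTop := Ultrafilter.of_le _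
  obtain ⟨c, hc, hc2⟩ := exists_code Ω
  obtain ⟨m, hm, hmP, hlim0⟩ := exists_limit P c hc U M hMp hMP
  have hlim1 : ∀ A : Set Ω, MeasurableSet A → ∀ φ : C(Y, ℝ),
      Tendsto (fun n => ∫ z, tst A φ z ∂(M n)) U (𝓝 (∫ z, tst A φ z ∂m)) :=
    fun A hA φ => limit_tst P c hc hc2 U M hMp hMP m hmP hlim0 hA φ
  have hmG := limit_G P hG hGcl U M hMP hMG m hmP hlim1
  have hlim : ∀ f : Ω × Y → ℝ, Measurable f → ∀ B : ℝ, (∀ z, |f z| ≤ B) →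
      (∀ᵐ ω ∂P, ContinuousOn (fun y => f (ω, y)) {y | (ω, y) ∈ G}) →
      Tendsto (fun n => ∫ z, f z ∂(M n)) U (𝓝 (∫ z, f z ∂m)) := fun f hf B hB hfc =>
    limit_all P hG hGcl U M hMp hMP hMG m hmP hmG hlim1 hf hB hfc
  have : IsProbabilityMeasure (m.map (skew ϑ S)) :=
    Measure.isProbabilityMeasure_map hΛ.aemeasurable
  have : IsProbabilityMeasure (m.map (factorMap πf)) :=
    Measure.isProbabilityMeasure_map hπm.aemeasurable
  refine ⟨m, hm, hmP, ?_, ?_, ?_⟩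
  · rw [← prob_compl_eq_zero_iff hG]
    exact hmG
  · apply ext_tst
    intro A hA φ
    have hfm : Measurable (tst A φ) := tst_meas hA φ.continuous.measurable
    have hfb : ∀ z : Ω × Y, |tst A φ z| ≤ ‖φ‖ := tst_bdd A (cont_bdd φ)
    have h1 := hlim (fun z => tst A φ (skew ϑ S z)) (hfm.comp hΛ) ‖φ‖ (fun z => hfb _) (by
      filter_upwards [hS.continuousOn] with ω hω
      have h : ContinuousOn (fun y => A.indicator (fun _ => (1:ℝ)) (ϑ ω) * φ (S ω y)) (fib G ω) :=
        ContinuousOn.mul continuousOn_const (φ.continuous.comp_continuousOn hω)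
      exact h)
    have h2 := hlim1 A hA φ
    rw [integral_map hΛ.aemeasurable hfm.aestronglyMeasurable]
    have hi : ∀ f : Ω × Y → ℝ, Measurable f → (∀ z, |f z| ≤ ‖φ‖) → ∀ n,
        ∫ z, f z ∂(M n) = ((n + 1 : ℕ) : ℝ)⁻¹ * ∑ k ∈ Finset.range (n + 1), ∫ z, f z ∂(ρ k) := by
      intro f hf hb n
      simp only [M]
      rw [integral_smul_measure, integral_finsetSum_measure
        (fun k _ => by have hpk := hρp k; exact int_bdd (ρ k) hf hb)]
      simp only [ENNReal.toReal_inv, ENNReal.toReal_natCast, smul_eq_mul]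
    have hdiff : ∀ n, ∫ z, tst A φ (skew ϑ S z) ∂(M n) - ∫ z, tst A φ z ∂(M n)
        = ((n + 1 : ℕ) : ℝ)⁻¹ * (∫ z, tst A φ z ∂(ρ (n+1)) - ∫ z, tst A φ z ∂(ρ 0)) := by
      intro n
      rw [hi (fun z => tst A φ (skew ϑ S z)) (hfm.comp hΛ) (fun z => hfb _), hi _ hfm hfb, ← mul_sub, ← Finset.sum_sub_distrib]
      refine Eq.trans ?_ (congrArg (fun t => ((n + 1 : ℕ) : ℝ)⁻¹ * t)
        (Finset.sum_range_sub (fun k => ∫ z, tst A φ z ∂(ρ k)) (n + 1)))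
      refine congrArg (fun t => ((n + 1 : ℕ) : ℝ)⁻¹ * t) ?_
      apply Finset.sum_congr rfl
      intro k _
      rw [hρs, integral_map hΛ.aemeasurable hfm.aestronglyMeasurable]
    have hab : ∀ k, |∫ z, tst A φ z ∂(ρ k)| ≤ ‖φ‖ := by
      intro k
      have hpk := hρp k
      have hfi : IsFiniteMeasure (ρ k) := ⟨by rw [hpk.measure_univ]; exact ENNReal.one_lt_top⟩
      have := @norm_integral_le_of_norm_le_const _ _ _ _ _ (ρ k) hfi (tst A φ) ‖φ‖
        (Eventually.of_forall hfb)
      have e : (ρ k).real univ = 1 := @probReal_univ _ _ (ρ k) (hρp k)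
      rw [e, mul_one] at this
      exact this
    have hz : Tendsto (fun n => ∫ z, tst A φ (skew ϑ S z) ∂(M n) - ∫ z, tst A φ z ∂(M n))
        atTop (𝓝 0) := by
      have hl : Tendsto (fun n : ℕ => ((n + 1 : ℕ) : ℝ)⁻¹ * (2 * ‖φ‖)) atTop (𝓝 0) := by
        have := (tendsto_inv_atTop_nhds_zero_nat (𝕜 := ℝ)).comp (tendsto_add_atTop_nat 1)
        simpa using this.mul_const (2 * ‖φ‖)
      refine squeeze_zero_norm (fun n => ?_) hl
      rw [hdiff, norm_mul, Real.norm_of_nonneg (by positivity)]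
      refine mul_le_mul_of_nonneg_left ?_ (by positivity)
      have h3 := hab (n+1)
      have h4 := hab 0
      rw [Real.norm_eq_abs]
      rw [abs_le] at *
      constructor <;> linarith [h3.1, h3.2, h4.1, h4.2]
    have := tendsto_nhds_unique (hz.mono_left hU) (h1.sub h2)
    linarith
  · apply ext_tst
    intro A hA φ
    have hfm : Measurable (tst A φ) := tst_meas hA φ.continuous.measurable
    have hfb : ∀ z : Ω × X, |tst A φ z| ≤ ‖φ‖ := tst_bdd A (cont_bdd φ)
    have h1 := hlim (fun z => tst A φ (factorMap πf z)) (hfm.comp hπm) ‖φ‖ (fun z => hfb _) (by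
      refine Eventually.of_forall fun ω => ?_
      have h : ContinuousOn (fun y => A.indicator (fun _ => (1:ℝ)) ω * φ (πf ω y)) (fib G ω) :=
        ContinuousOn.mul continuousOn_const (φ.continuous.comp_continuousOn (hπ.continuousOn ω))
      exact h)
    rw [integral_map hπm.aemeasurable hfm.aestronglyMeasurable]
    have h2 : ∀ n, ∫ z, tst A φ (factorMap πf z) ∂(M n) = ∫ z, tst A φ z ∂μ := by
      intro n
      rw [← hMπ n, integral_map hπm.aemeasurable hfm.aestronglyMeasurable]
    simp only [h2] at h1
    exact (tendsto_nhds_unique tendsto_const_nhds h1).symm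

end RelTail
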